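/- arXiv:2310.12275 — 2 statements merged into one kernel-verified Lean document; each statement's English description precedes it below -/
import Mathlib

section
/- For every real t with 0 < t < 1, every real χ > 0, every L ∈ ℤ and every x ∈ ℤ_{≥0}, one has F_{t,χ}(L,x) ≥ 0. -/
open scoped BigOperators

/-- `(t;t)_n = ∏_{r=1}^{n} (1 - t^r)`. -/
noncomputable def tPochN (t : ℝ) (n : ℕ) : ℝ := ∏ r ∈ Finset.range n, (1 - t ^ (r + 1))

/-- `(t;t)_∞ = ∏_{r=1}^{∞} (1 - t^r)`. -/
noncomputable def tPochInf (t : ℝ) : ℝ := ∏' r : ℕ, (1 - t ^ (r + 1))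

/-- The `t`-binomial coefficient `[n choose c]_t` for natural `c ≤ n`, `0` otherwise. -/
noncomputable def tBinomN (t : ℝ) (n c : ℕ) : ℝ :=
  if c ≤ n then tPochN t n / (tPochN t c * tPochN t (n - c)) else 0

/-- The `m`-th term of the series defining `F_{t,χ}(L,x)`. -/
noncomputable def Fterm (t χ : ℝ) (L : ℤ) (x m : ℕ) : ℝ :=
  Real.exp (-χ * t ^ (L - (m : ℤ))) * (-1) ^ m *
    t ^ ((m : ℤ) ^ 2 + ((x : ℤ) - 1) * (m : ℤ) + (x : ℤ) * ((x : ℤ) - 1) / 2) *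
    ∑ i ∈ Finset.range (x + 1),
      ((-1) ^ (x - i) / tPochN t (x - i)) * tBinomN t (m + i) i *
        ((t ^ (L - (m : ℤ)) * χ) ^ (i + m) / ((i + m).factorial : ℝ) +
          if 1 ≤ i + m then (t ^ (L - (m : ℤ)) * χ) ^ (i + m - 1) / (((i + m - 1).factorial : ℝ))
          else 0)

/-- `F_{t,χ}(L,x) = Pr(𝓛_{2,t,χ} = (L+x,L))`. -/
noncomputable def Fweight (t χ : ℝ) (L : ℤ) (x : ℕ) : ℝ :=
  (tPochInf t)⁻¹ * ∑' m : ℕ, Fterm t χ L x m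

noncomputable def zA (t : ℝ) (m i : ℕ) : ℝ := tPochN t (m + i) / (tPochN t m * tPochN t i)
noncomputable def zw (t : ℝ) (a : ℕ) : ℝ := (-1) ^ a / tPochN t a
def zE (x m : ℕ) : ℕ := 2 * m.choose 2 + x * m + x.choose 2
noncomputable def zc (t : ℝ) (j k : ℕ) : ℝ :=
  t ^ (j * k + k.choose 2) * (t ^ k + (1 - t ^ k) / t ^ j) / (tPochN t k * tPochN t j)
noncomputable def zq (t : ℝ) (j k : ℕ) (τ : ℝ) : ℝ :=
  ∑ l ∈ Finset.range (k + 1), zc t j l * (τ ^ (k - l) / ((k - l).factorial : ℝ))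
noncomputable def zQ (t : ℝ) (x m j : ℕ) (τ : ℝ) : ℝ :=
  (-1) ^ m * t ^ zE x m * ∑ i ∈ Finset.range (x + 1), zw t (x - i) * zA t m i * zq t j (i + m) τ
noncomputable def zp (t : ℝ) (x r : ℕ) (χ : ℝ) : ℝ :=
  ∑ m ∈ Finset.range (r + 1), Real.exp (-(χ * t ^ (r - m))) * zQ t x m (r - m) (χ * t ^ (r - m))

lemma zP_succ (t : ℝ) (n : ℕ) : tPochN t (n + 1) = tPochN t n * (1 - t ^ (n + 1)) := by
  simp [tPochN, Finset.prod_range_succ]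

lemma zP_zero (t : ℝ) : tPochN t 0 = 1 := by simp [tPochN]

lemma zone_sub {t : ℝ} (ht0 : 0 < t) (ht1 : t < 1) (n : ℕ) : 0 < 1 - t ^ (n + 1) := by
  have := pow_lt_one₀ ht0.le ht1 (Nat.succ_ne_zero n)
  simpa using this

lemma zP_pos {t : ℝ} (ht0 : 0 < t) (ht1 : t < 1) (n : ℕ) : 0 < tPochN t n :=
  Finset.prod_pos fun r _ => zone_sub ht0 ht1 r

lemma zchoose_succ (n : ℕ) : (n + 1).choose 2 = n.choose 2 + n := by
  rw [Nat.choose_succ_succ' n 1]; simp [add_comm]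

lemma zE_x (x m : ℕ) : zE (x + 1) m = zE x m + (m + x) := by
  simp only [zE, zchoose_succ]; ring

lemma zE_m (x m : ℕ) : zE x (m + 1) = zE (x + 1) m + m := by
  simp only [zE, zchoose_succ]; ring

lemma zchoose_add (i m : ℕ) : (i + m).choose 2 = i.choose 2 + m.choose 2 + i * m := by
  induction m with
  | zero => simp
  | succ m ih => rw [← add_assoc, zchoose_succ, zchoose_succ, ih]; ring

/-- q-binomial theorem -/
lemma zgauss {t : ℝ} (ht0 : 0 < t) (ht1 : t < 1) (z : ℝ) (n : ℕ) :
    ∑ i ∈ Finset.range (n + 1), (-1) ^ i * t ^ (i.choose 2) * z ^ i /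
      (tPochN t i * tPochN t (n - i)) = (∏ s ∈ Finset.range n, (1 - z * t ^ s)) / tPochN t n := by
  induction n with
  | zero => simp [zP_zero]
  | succ n ih =>
    have key : ∀ i ∈ Finset.range n, (-1) ^ (i+1) * t ^ ((i+1).choose 2) * z ^ (i+1) /
      (tPochN t (i+1) * tPochN t (n + 1 - (i+1))) * (1 - t ^ (n + 1)) =
      (-1) ^ (i+1) * t ^ ((i+1).choose 2) * z ^ (i+1) / (tPochN t (i+1) * tPochN t (n - (i+1)))
      + (- z * t ^ n) * ((-1) ^ i * t ^ (i.choose 2) * z ^ i /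
      (tPochN t i * tPochN t (n - i))) := by
      intro i hi
      obtain ⟨d, rfl⟩ := Nat.exists_eq_add_of_lt (Finset.mem_range.1 hi)
      have e1 : i + d + 1 + 1 - (i + 1) = d + 1 := by omega
      have e2 : i + d + 1 - (i + 1) = d := by omega
      have e3 : i + d + 1 - i = d + 1 := by omega
      rw [e1, e2, e3, zP_succ, zP_succ, zchoose_succ]
      have h1 := (zP_pos ht0 ht1 i).ne'
      have h2 := (zP_pos ht0 ht1 d).ne'
      have h3 := (zone_sub ht0 ht1 i).ne'
      have h4 := (zone_sub ht0 ht1 d).ne'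
      field_simp
      ring
    have h0 := (zone_sub ht0 ht1 n).ne'
    have hn := (zP_pos ht0 ht1 n).ne'
    rw [Finset.prod_range_succ, zP_succ, eq_div_iff (mul_ne_zero hn h0), ← mul_assoc, mul_right_comm]
    rw [eq_div_iff hn] at ih
    rw [← ih, mul_right_comm _ (tPochN t n)]
    congr 1
    rw [Finset.sum_mul, Finset.sum_range_succ, Finset.sum_range_succ', Finset.sum_congr rfl key,
      Finset.sum_add_distrib, ← Finset.mul_sum, mul_one_sub]
    have := Finset.sum_range_succ' (fun i => (-1) ^ i * t ^ (i.choose 2) * z ^ i /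
      (tPochN t i * tPochN t (n - i))) n
    have h2 := Finset.sum_range_succ (fun i => (-1) ^ i * t ^ (i.choose 2) * z ^ i /
      (tPochN t i * tPochN t (n - i))) n
    rw [h2] at this
    have e5 := eq_sub_of_add_eq this.symm
    rw [e5, h2]
    have e4 : (0:ℕ).choose 2 = 0 := rfl
    simp only [Nat.sub_self, zP_zero, zP_succ, zchoose_succ, Nat.sub_zero, e4]
    field_simp
    ring

lemma zq_zero (t : ℝ) (j k : ℕ) : zq t j k 0 = zc t j k := by
  rw [zq, Finset.sum_range_succ, Finset.sum_eq_zero]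
  · simp
  · intro l hl
    have : k - l ≠ 0 := by have := Finset.mem_range.1 hl; omega
    simp [this]

lemma zq_deriv0 (t : ℝ) (j : ℕ) (τ : ℝ) : HasDerivAt (zq t j 0) 0 τ := by
  have : zq t j 0 = fun _ => zc t j 0 := by funext s; simp [zq]
  rw [this]; exact hasDerivAt_const _ _

lemma zq_deriv (t : ℝ) (j k : ℕ) (τ : ℝ) : HasDerivAt (zq t j (k+1)) (zq t j k τ) τ := by
  have : zq t j (k+1) = fun τ => (∑ l ∈ Finset.range (k + 1),
    zc t j l * (τ ^ (k + 1 - l) / ((k + 1 - l).factorial : ℝ))) + zc t j (k+1) := by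
    funext s; simp [zq, Finset.sum_range_succ _ (k+1)]
  rw [this]
  unfold zq
  refine HasDerivAt.add_const _ (HasDerivAt.fun_sum fun l hl => ?_)
  refine HasDerivAt.const_mul _ ?_
  have e : k + 1 - l = (k - l) + 1 := by have := Finset.mem_range.1 hl; omega
  rw [e]
  have := (hasDerivAt_pow (k - l + 1) τ).div_const ((k - l + 1).factorial : ℝ)
  convert this using 1
  rw [Nat.factorial_succ]
  have : ((k-l).factorial : ℝ) ≠ 0 := by positivity
  push_cast
  field_simp

noncomputable def zQx (t : ℝ) (x m j : ℕ) (τ : ℝ) : ℝ :=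
  match x with
  | 0 => 0
  | x + 1 => t ^ (m + x) * zQ t x m j τ
noncomputable def zQm (t : ℝ) (x m j : ℕ) (τ : ℝ) : ℝ :=
  match m with
  | 0 => 0
  | m + 1 => t ^ m * (1 - t ^ (x + 1)) * zQ t (x + 1) m j τ

lemma zw_rec {t : ℝ} (ht0 : 0 < t) (ht1 : t < 1) (a : ℕ) :
    zw t a = - zw t (a + 1) * (1 - t ^ (a + 1)) := by
  have h1 := (zP_pos ht0 ht1 a).ne'
  have h3 := (zone_sub ht0 ht1 a).ne'
  rw [zw, zw, zP_succ]; field_simp; ring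

lemma zA_coef {t : ℝ} (ht0 : 0 < t) (ht1 : t < 1) (m a i : ℕ) :
    zw t a * zA t (m+1) (i+1) = (1 - t ^ (m+1)) * zw t (a+1) * zA t (m+1) i
      + zw t a * zA t (m+1) i - (1 - t ^ (a+i+1+1)) * zw t (a+1) * zA t m (i+1) := by
  have h1 := (zP_pos ht0 ht1 m).ne'
  have h2 := (zP_pos ht0 ht1 i).ne'
  have h3 := (zone_sub ht0 ht1 m).ne'
  have h4 := (zone_sub ht0 ht1 i).ne'
  rw [zw_rec ht0 ht1 a]
  simp only [zA, show m + 1 + (i+1) = m + i + 1 + 1 by ring, show m + 1 + i = m + i + 1 by ring,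
    show m + (i+1) = m + i + 1 by ring, zP_succ]
  field_simp
  ring

lemma zQ_deriv {t : ℝ} (ht0 : 0 < t) (ht1 : t < 1) (x m j : ℕ) (τ : ℝ) :
    HasDerivAt (zQ t x m j) ((1 - t ^ m) * zQ t x m j τ + zQx t x m j τ + zQm t x m j τ) τ := by
  cases m with
  | zero =>
    have hA : ∀ i, zA t 0 i = 1 := by
      intro i
      have h1 := (zP_pos ht0 ht1 i).ne'
      simp [zA, zP_zero, h1]
    cases x with
    | zero =>
      have : zQ t 0 0 j = fun τ => t ^ zE 0 0 * (zw t 0 * zq t j 0 τ) := by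
        funext s; simp [zQ, hA]
      rw [this]
      simpa [zQx, zQm] using ((zq_deriv0 t j τ).const_mul (zw t 0)).const_mul (t ^ zE 0 0)
    | succ x =>
      have : zQ t (x+1) 0 j = fun τ => t ^ zE (x+1) 0 * (∑ i ∈ Finset.range (x+1),
          zw t (x - i) * zq t j (i + 1) τ + zw t (x + 1) * zq t j 0 τ) := by
        funext s; simp [zQ, hA, Finset.sum_range_succ']
      rw [this]
      have h := ((HasDerivAt.fun_sum (u := Finset.range (x+1)) fun i _ =>
        (zq_deriv t j i τ).const_mul (zw t (x - i))).add
          ((zq_deriv0 t j τ).const_mul (zw t (x+1)))).const_mul (t ^ zE (x+1) 0)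
      refine HasDerivAt.congr_deriv h ?_
      simp [zQx, zQm, zQ, hA, zE_x]
      ring
  | succ m =>
    have h : HasDerivAt (zQ t x (m+1) j) ((-1) ^ (m+1) * t ^ zE x (m+1) *
      ∑ i ∈ Finset.range (x + 1), zw t (x - i) * zA t (m+1) i * zq t j (i + m) τ) τ := by
      unfold zQ
      exact (HasDerivAt.fun_sum fun i _ => (zq_deriv t j (i+m) τ).const_mul _).const_mul _
    convert h using 1
    have hx : zQx t x (m+1) j τ = (-1) ^ (m+1) * t ^ zE x (m+1) *
        ∑ i ∈ Finset.range x, zw t (x - (i + 1)) * zA t (m+1) i * zq t j (i + 1 + m) τ := by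
      cases x with
      | zero => simp [zQx]
      | succ x =>
        simp only [zQx, zQ, zE_x]
        simp only [Nat.add_sub_add_right, show ∀ i, i + (m + 1) = i + 1 + m from fun i => by ring]
        ring
    rw [hx]
    simp only [zQm, zQ]
    have e : t ^ zE x (m+1) = t ^ zE (x+1) m * t ^ m := by rw [zE_m, pow_add]
    rw [e]
    have hA0 : ∀ m, zA t m 0 = 1 := by
      intro m
      have h1 := (zP_pos ht0 ht1 m).ne'
      simp [zA, zP_zero, h1]
    have hS : ∑ i ∈ Finset.range (x + 1), zw t (x - i) * zA t (m+1) i * zq t j (i + m) τ =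
      (1 - t ^ (m+1)) * ∑ i ∈ Finset.range (x + 1), zw t (x - i) * zA t (m+1) i * zq t j (i + (m+1)) τ
      + ∑ i ∈ Finset.range x, zw t (x - (i + 1)) * zA t (m+1) i * zq t j (i + 1 + m) τ
      - (1 - t ^ (x+1)) * ∑ i ∈ Finset.range (x + 1 + 1), zw t (x + 1 - i) * zA t m i * zq t j (i + m) τ := by
      rw [Finset.sum_range_succ', Finset.sum_range_succ _ x, Finset.sum_range_succ' _ (x+1),
        Finset.sum_range_succ _ x]
      have key : ∀ i ∈ Finset.range x, zw t (x - (i+1)) * zA t (m+1) (i+1) * zq t j (i + 1 + m) τ =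
        (1 - t ^ (m+1)) * (zw t (x - i) * zA t (m+1) i * zq t j (i + (m+1)) τ)
        + zw t (x - (i + 1)) * zA t (m+1) i * zq t j (i + 1 + m) τ
        - (1 - t ^ (x+1)) * (zw t (x + 1 - (i + 1)) * zA t m (i+1) * zq t j (i + 1 + m) τ) := by
        intro i hi
        obtain ⟨d, rfl⟩ := Nat.exists_eq_add_of_lt (Finset.mem_range.1 hi)
        have := zA_coef ht0 ht1 m d i
        rw [show i + d + 1 - (i+1) = d by omega, show i + d + 1 - i = d + 1 by omega,
          show i + d + 1 + 1 - (i+1) = d + 1 by omega, this,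
          show i + (m+1) = i + 1 + m by ring, show i + d + 1 + 1 = d + i + 1 + 1 by ring]
        ring
      rw [Finset.sum_congr rfl key, Finset.sum_sub_distrib, Finset.sum_add_distrib,
        ← Finset.mul_sum, ← Finset.mul_sum]
      simp only [hA0, Nat.sub_self, Nat.sub_zero, Nat.add_sub_add_right]
      have hw := zw_rec ht0 ht1 x
      have hl : (1 - t ^ (m+1)) * zA t (m+1) x = (1 - t ^ (x+1)) * zA t m (x+1) := by
        have h1 := (zP_pos ht0 ht1 m).ne'
        have h2 := (zP_pos ht0 ht1 x).ne'
        have h3 := (zone_sub ht0 ht1 m).ne'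
        have h4 := (zone_sub ht0 ht1 x).ne'
        simp only [zA, show m + 1 + x = m + x + 1 by ring,
          show m + (x+1) = m + x + 1 by ring, zP_succ]
        field_simp
      rw [show x + (m+1) = x + 1 + m by ring, hw]
      linear_combination (-zw t 0 * zq t j (x+1+m) τ) * hl
    rw [hS]
    ring

noncomputable def zpx (t : ℝ) (x r : ℕ) (χ : ℝ) : ℝ :=
  match x with
  | 0 => 0
  | x + 1 => t ^ (r + x) * zp t x r χ
noncomputable def zpm (t : ℝ) (x r : ℕ) (χ : ℝ) : ℝ :=
  match r with
  | 0 => 0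
  | r + 1 => t ^ r * (1 - t ^ (x + 1)) * zp t (x + 1) r χ

lemma zp_deriv {t : ℝ} (ht0 : 0 < t) (ht1 : t < 1) (x r : ℕ) (χ : ℝ) :
    HasDerivAt (zp t x r) (-t ^ r * zp t x r χ + (zpx t x r χ + zpm t x r χ)) χ := by
  have h : HasDerivAt (zp t x r) (∑ m ∈ Finset.range (r + 1),
      (Real.exp (-(χ * t ^ (r - m))) * (-(1 * t ^ (r - m))) * zQ t x m (r - m) (χ * t ^ (r - m)) +
       Real.exp (-(χ * t ^ (r - m))) * (((1 - t ^ m) * zQ t x m (r - m) (χ * t ^ (r - m))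
        + zQx t x m (r - m) (χ * t ^ (r - m)) + zQm t x m (r - m) (χ * t ^ (r - m)))
          * (1 * t ^ (r - m))))) χ := by
    unfold zp
    refine HasDerivAt.fun_sum fun m _ => ?_
    have h1 : HasDerivAt (fun χ : ℝ => χ * t ^ (r - m)) (1 * t ^ (r - m)) χ :=
      (hasDerivAt_id χ).mul_const _
    exact h1.neg.exp.mul ((zQ_deriv ht0 ht1 x m (r - m) _).comp χ h1)
  refine h.congr_deriv ?_
  have hx : zpx t x r χ = ∑ m ∈ Finset.range (r + 1), Real.exp (-(χ * t ^ (r - m))) *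
      (zQx t x m (r - m) (χ * t ^ (r - m)) * t ^ (r - m)) := by
    cases x with
    | zero => simp [zpx, zQx]
    | succ x =>
      simp only [zpx, zQx, zp, Finset.mul_sum]
      refine Finset.sum_congr rfl fun m hm => ?_
      obtain ⟨d, rfl⟩ := Nat.exists_eq_add_of_le (Nat.lt_succ_iff.1 (Finset.mem_range.1 hm))
      rw [Nat.add_sub_cancel_left]
      ring
  have hm : zpm t x r χ = ∑ m ∈ Finset.range (r + 1), Real.exp (-(χ * t ^ (r - m))) *
      (zQm t x m (r - m) (χ * t ^ (r - m)) * t ^ (r - m)) := by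
    cases r with
    | zero => simp [zpm, zQm]
    | succ r =>
      rw [Finset.sum_range_succ']
      simp only [zpm, zQm, zp, Finset.mul_sum, Nat.add_sub_add_right]
      simp only [zero_mul, mul_zero, add_zero]
      refine Finset.sum_congr rfl fun m hm => ?_
      obtain ⟨d, rfl⟩ := Nat.exists_eq_add_of_le (Nat.lt_succ_iff.1 (Finset.mem_range.1 hm))
      rw [Nat.add_sub_cancel_left]
      ring
  rw [hx, hm, zp, Finset.mul_sum, ← Finset.sum_add_distrib, ← Finset.sum_add_distrib]
  refine Finset.sum_congr rfl fun m hm => ?_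
  obtain ⟨d, rfl⟩ := Nat.exists_eq_add_of_le (Nat.lt_succ_iff.1 (Finset.mem_range.1 hm))
  rw [Nat.add_sub_cancel_left]
  ring

lemma zprod_shift (t z : ℝ) (n : ℕ) :
    (1 - z) * ∏ s ∈ Finset.range n, (1 - z * t * t ^ s) =
      (∏ s ∈ Finset.range n, (1 - z * t ^ s)) * (1 - z * t ^ n) := by
  rw [← Finset.prod_range_succ, Finset.prod_range_succ', mul_comm]
  simp only [pow_zero, mul_one]
  congr 1
  refine Finset.prod_congr rfl fun s _ => ?_
  ring

noncomputable def zf (t z : ℝ) (n i : ℕ) : ℝ :=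
  (-1) ^ i * t ^ (i.choose 2) * z ^ i / (tPochN t i * tPochN t (n - i))

lemma ztwo (m : ℕ) : 2 * m.choose 2 + m = m * m := by
  induction m with
  | zero => rfl
  | succ m ih => rw [zchoose_succ]; nlinarith

lemma zterm {t : ℝ} (ht0 : 0 < t) (ht1 : t < 1) (m d i a : ℕ) :
    (-1) ^ m * t ^ zE (i + a) m * (zw t a * zA t m i * zc t d (i + m)) =
    (-1) ^ (i + a) * t ^ (i + a).choose 2 * (zf t (t ^ (m + d + 1)) (i + a) i * zf t (t ^ (m + d + (i + a))) (m + d) m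
      + (zf t (t ^ (m + d)) (i + a) i * zf t (t ^ (m + d + (i + a))) (m + d) m
        - zf t (t ^ (m + d + 1)) (i + a) i * zf t (t ^ (m + d + (i + a) + 1)) (m + d) m) / t ^ (m + d)) := by
  have hE : t ^ zE (i + a) m = t ^ (m * m) / t ^ m * t ^ ((i + a) * m) * t ^ (i + a).choose 2 := by
    rw [zE, ← ztwo m, pow_add, pow_add, pow_add]
    field_simp
  have hs : zw t a = (-1) ^ (i + a) * (-1) ^ i / tPochN t a := by
    rw [zw, pow_add, mul_right_comm, ← mul_pow]; simp
  have h1 := (zP_pos ht0 ht1 m).ne'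
  have h2 := (zP_pos ht0 ht1 i).ne'
  have h3 := (zP_pos ht0 ht1 d).ne'
  have h4 := (zP_pos ht0 ht1 a).ne'
  have h5 := (zP_pos ht0 ht1 (i + m)).ne'
  have ht := ht0.ne'
  rw [hE, hs]
  simp only [zf, zA, zc, zchoose_add i m, Nat.add_sub_cancel_left, add_comm m i]
  generalize (i + a).choose 2 = Y
  generalize hsg : ((-1 : ℝ)) ^ (i + a) = sg
  field_simp
  ring

lemma zinit {t : ℝ} (ht0 : 0 < t) (ht1 : t < 1) (x r : ℕ) : 0 ≤ zp t x r 0 := by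
  have h : zp t x r 0 = (-1) ^ x * t ^ x.choose 2 *
    ((∑ i ∈ Finset.range (x+1), zf t (t ^ (r + 1)) x i) * (∑ m ∈ Finset.range (r+1), zf t (t ^ (r + x)) r m)
     + ((∑ i ∈ Finset.range (x+1), zf t (t ^ r) x i) * (∑ m ∈ Finset.range (r+1), zf t (t ^ (r + x)) r m)
      - (∑ i ∈ Finset.range (x+1), zf t (t ^ (r + 1)) x i) * (∑ m ∈ Finset.range (r+1), zf t (t ^ (r + x + 1)) r m)) / t ^ r) := by
    simp only [Finset.sum_mul_sum]
    rw [← Finset.sum_sub_distrib, Finset.sum_div, ← Finset.sum_add_distrib]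
    simp only [← Finset.sum_sub_distrib, Finset.sum_div, ← Finset.sum_add_distrib]
    rw [Finset.sum_comm, Finset.mul_sum, zp]
    refine Finset.sum_congr rfl fun m hm => ?_
    simp only [zero_mul, neg_zero, Real.exp_zero, one_mul, zQ, Finset.mul_sum, zq_zero]
    refine Finset.sum_congr rfl fun i hi => ?_
    obtain ⟨d, rfl⟩ := Nat.exists_eq_add_of_le (Nat.lt_succ_iff.1 (Finset.mem_range.1 hm))
    obtain ⟨a, rfl⟩ := Nat.exists_eq_add_of_le (Nat.lt_succ_iff.1 (Finset.mem_range.1 hi))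
    have := zterm ht0 ht1 m d i a
    rw [Nat.add_sub_cancel_left, Nat.add_sub_cancel_left]
    exact this
  by_cases h0 : r + x = 0
  · obtain ⟨rfl, rfl⟩ : r = 0 ∧ x = 0 := by omega
    rw [h]; simp [zf, zP_zero]
  refine le_of_eq ?_
  rw [h]
  simp only [zf, zgauss ht0 ht1]
  have s1 := zprod_shift t (t ^ r) x
  have s2 := zprod_shift t (t ^ (r + x)) r
  rw [← pow_succ] at s1 s2
  generalize (∏ s ∈ Finset.range x, (1 - t ^ (r + 1) * t ^ s)) = A0 at *
  generalize (∏ s ∈ Finset.range x, (1 - t ^ r * t ^ s)) = A1 at *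
  generalize (∏ s ∈ Finset.range r, (1 - t ^ (r + x) * t ^ s)) = M0 at *
  generalize (∏ s ∈ Finset.range r, (1 - t ^ (r + x + 1) * t ^ s)) = M1 at *
  have hv : 1 - t ^ (r + x) ≠ 0 := by
    obtain ⟨n, hn⟩ := Nat.exists_eq_succ_of_ne_zero h0
    rw [hn]; exact (zone_sub ht0 ht1 n).ne'
  have hx := (zP_pos ht0 ht1 x).ne'
  have hr := (zP_pos ht0 ht1 r).ne'
  have hA : A1 = (1 - t ^ r) * A0 / (1 - t ^ (r + x)) := by
    rw [eq_div_iff hv, pow_add, s1]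
  have hM : M1 = M0 * (1 - t ^ (r + x) * t ^ r) / (1 - t ^ (r + x)) := by
    rw [eq_div_iff hv, ← s2, mul_comm]
  rw [hA, hM]
  have ht := ht0.ne'
  symm
  apply mul_eq_zero_of_right
  field_simp
  ring

lemma zode {f g : ℝ → ℝ} {a : ℝ} (hf : ∀ s, HasDerivAt f (-a * f s + g s) s)
    (hg : ∀ s, 0 ≤ s → 0 ≤ g s) (h0 : 0 ≤ f 0) (s : ℝ) (hs : 0 ≤ s) : 0 ≤ f s := by
  have hd : ∀ s, HasDerivAt (fun s => Real.exp (a * s) * f s) (Real.exp (a * s) * g s) s := by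
    intro s
    have h1 : HasDerivAt (fun s : ℝ => a * s) (a * 1) s := (hasDerivAt_id s).const_mul a
    refine (h1.exp.mul (hf s)).congr_deriv ?_
    ring
  have hm : MonotoneOn (fun s => Real.exp (a * s) * f s) (Set.Ici 0) := by
    apply monotoneOn_of_deriv_nonneg (convex_Ici 0)
    · exact fun s _ => (hd s).continuousAt.continuousWithinAt
    · exact fun s _ => (hd s).differentiableAt.differentiableWithinAt
    · intro s hs
      rw [interior_Ici] at hs
      rw [(hd s).deriv]
      exact mul_nonneg (Real.exp_pos _).le (hg s (le_of_lt hs))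
  have := hm (Set.mem_Ici.2 le_rfl) (Set.mem_Ici.2 hs) hs
  simp only [mul_zero, Real.exp_zero, one_mul] at this
  exact nonneg_of_mul_nonneg_right (h0.trans this) (Real.exp_pos _)

lemma zp_nonneg {t : ℝ} (ht0 : 0 < t) (ht1 : t < 1) (r : ℕ) :
    ∀ x s, 0 ≤ s → 0 ≤ zp t x r s := by
  induction r with
  | zero =>
    intro x
    induction x with
    | zero =>
      refine zode (zp_deriv ht0 ht1 0 0) (fun s hs => ?_) (zinit ht0 ht1 _ _)
      simp [zpx, zpm]
    | succ x ih =>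
      refine zode (zp_deriv ht0 ht1 (x+1) 0) (fun s hs => ?_) (zinit ht0 ht1 _ _)
      have := ih s hs
      simp only [zpx, zpm]; positivity
  | succ r ihr =>
    have h2 : ∀ x s, 0 ≤ s → 0 ≤ zpm t x (r+1) s := by
      intro x s hs
      have h3 := ihr (x+1) s hs
      have h4 := zone_sub ht0 ht1 x
      simp only [zpm]; positivity
    intro x
    induction x with
    | zero =>
      refine zode (zp_deriv ht0 ht1 0 (r+1)) (fun s hs => ?_) (zinit ht0 ht1 _ _)
      have := h2 0 s hs
      simpa [zpx] using this
    | succ x ih =>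
      refine zode (zp_deriv ht0 ht1 (x+1) (r+1)) (fun s hs => ?_) (zinit ht0 ht1 _ _)
      have h1 := ih s hs
      have := h2 (x+1) s hs
      refine add_nonneg ?_ this
      simp only [zpx]; positivity

open Filter Topology in
lemma zP_tendsto {t : ℝ} (ht0 : 0 < t) (ht1 : t < 1) :
    Tendsto (tPochN t) atTop (𝓝 (tPochInf t)) := by
  have hs : Summable fun r : ℕ => -(t ^ (r + 1)) :=
    ((summable_nat_add_iff 1).2 (summable_geometric_of_lt_one ht0.le ht1)).neg
  have hm : Multipliable fun r : ℕ => (1 - t ^ (r + 1)) := by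
    simpa [sub_eq_add_neg] using Real.multipliable_one_add_of_summable hs
  exact hm.hasProd.tendsto_prod_nat

lemma zP_anti {t : ℝ} (ht0 : 0 < t) (ht1 : t < 1) : Antitone (tPochN t) := by
  refine antitone_nat_of_succ_le fun n => ?_
  rw [zP_succ]
  have := zP_pos ht0 ht1 n
  have h : 0 < t ^ (n+1) := by positivity
  nlinarith

lemma zP_le_one {t : ℝ} (ht0 : 0 < t) (ht1 : t < 1) (n : ℕ) : tPochN t n ≤ 1 := by
  simpa [zP_zero] using zP_anti ht0 ht1 (Nat.zero_le n)

lemma zP_ge {t : ℝ} (ht0 : 0 < t) (ht1 : t < 1) (n : ℕ) : tPochInf t ≤ tPochN t n :=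
  (zP_anti ht0 ht1).le_of_tendsto (zP_tendsto ht0 ht1) n

lemma zc_nonneg {t : ℝ} (ht0 : 0 < t) (ht1 : t < 1) (j k : ℕ) : 0 ≤ zc t j k := by
  have h1 := zP_pos ht0 ht1 k
  have h2 := zP_pos ht0 ht1 j
  have h3 : 0 ≤ 1 - t ^ k := sub_nonneg.2 (pow_le_one₀ ht0.le ht1.le)
  unfold zc; positivity

lemma zc_le {t : ℝ} (ht0 : 0 < t) (ht1 : t < 1) (hp : 0 < tPochInf t) (j k : ℕ) :
    zc t j k ≤ 2 / (tPochInf t * tPochInf t) := by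
  have h1 := zP_ge ht0 ht1 k
  have h2 := zP_ge ht0 ht1 j
  have hn : t ^ (j * k + k.choose 2) * (t ^ k + (1 - t ^ k) / t ^ j) ≤ 2 := by
    cases k with
    | zero => simp
    | succ k =>
      have e : t ^ (j * (k+1) + (k+1).choose 2) * (t ^ (k+1) + (1 - t ^ (k+1)) / t ^ j) =
        t ^ (j * (k+1) + (k+1).choose 2 + (k+1)) + t ^ (j * k + (k+1).choose 2) * (1 - t ^ (k+1)) := by
        have := ht0.ne'
        generalize (k+1).choose 2 = Y
        field_simp
        ring
      rw [e]
      have a1 : t ^ (j * (k+1) + (k+1).choose 2 + (k+1)) ≤ 1 := pow_le_one₀ ht0.le ht1.le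
      have a2 : t ^ (j * k + (k+1).choose 2) ≤ 1 := pow_le_one₀ ht0.le ht1.le
      have a3 : 0 < t ^ (k+1) := by positivity
      have a4 := zone_sub ht0 ht1 k
      nlinarith
  have h3 := zP_pos ht0 ht1 k
  unfold zc
  gcongr

lemma zq_nonneg {t : ℝ} (ht0 : 0 < t) (ht1 : t < 1) (j k : ℕ) {τ : ℝ} (hτ : 0 ≤ τ) :
    0 ≤ zq t j k τ :=
  Finset.sum_nonneg fun l _ => mul_nonneg (zc_nonneg ht0 ht1 j l) (by positivity)

lemma zq_le {t : ℝ} (ht0 : 0 < t) (ht1 : t < 1) (hp : 0 < tPochInf t) (j k : ℕ) {τ : ℝ}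
    (hτ : 0 ≤ τ) : zq t j k τ ≤ 2 / (tPochInf t * tPochInf t) * Real.exp τ := by
  calc zq t j k τ ≤ ∑ l ∈ Finset.range (k+1), 2 / (tPochInf t * tPochInf t) *
        (τ ^ (k - l) / ((k - l).factorial : ℝ)) := by
        refine Finset.sum_le_sum fun l _ => ?_
        exact mul_le_mul_of_nonneg_right (zc_le ht0 ht1 hp j l) (by positivity)
    _ = 2 / (tPochInf t * tPochInf t) * ∑ l ∈ Finset.range (k+1), (τ ^ l / (l.factorial : ℝ)) := by
        rw [← Finset.mul_sum]
        congr 1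
        exact Finset.sum_range_reflect (fun l => τ ^ l / (l.factorial : ℝ)) (k+1)
    _ ≤ _ := by
        have := Real.sum_le_exp_of_nonneg hτ (k+1)
        gcongr

lemma zQ_bound {t : ℝ} (ht0 : 0 < t) (ht1 : t < 1) (hp : 0 < tPochInf t) (x m j : ℕ) {τ : ℝ}
    (hτ : 0 ≤ τ) : |Real.exp (-τ) * zQ t x m j τ| ≤
      ((x + 1 : ℕ) * (1 / tPochInf t * (1 / (tPochInf t * tPochInf t)) *
        (2 / (tPochInf t * tPochInf t))) / t) * t ^ m := by
  set p := tPochInf t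
  have hS : |∑ i ∈ Finset.range (x + 1), zw t (x - i) * zA t m i * zq t j (i + m) τ| ≤
      (x + 1 : ℕ) * (1 / p * (1 / (p * p)) * (2 / (p * p) * Real.exp τ)) := by
    refine (Finset.abs_sum_le_sum_abs _ _).trans ?_
    refine (Finset.sum_le_card_nsmul _ _ (1 / p * (1 / (p * p)) * (2 / (p * p) * Real.exp τ)) ?_).trans ?_
    · intro i _
      have hw : |zw t (x - i)| ≤ 1 / p := by
        have := zP_pos ht0 ht1 (x - i)
        have h2 := zP_ge ht0 ht1 (x - i)
        rw [zw, abs_div, abs_pow, abs_neg, abs_one, one_pow, abs_of_pos this]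
        gcongr
      have hA : |zA t m i| ≤ 1 / (p * p) := by
        have h1 := zP_pos ht0 ht1 m
        have h2 := zP_pos ht0 ht1 i
        have h3 := zP_pos ht0 ht1 (m + i)
        have h4 := zP_ge ht0 ht1 m
        have h5 := zP_ge ht0 ht1 i
        have h6 := zP_le_one ht0 ht1 (m + i)
        rw [zA, abs_of_pos (by positivity)]
        gcongr
      have hq := zq_le ht0 ht1 hp j (i + m) hτ
      rw [abs_mul, abs_mul, abs_of_nonneg (zq_nonneg ht0 ht1 j (i+m) hτ)]
      have := zq_nonneg ht0 ht1 j (i+m) hτ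
      gcongr
    · simp
  have hE : t ^ zE x m ≤ t ^ m / t := by
    rw [le_div_iff₀ ht0, ← pow_succ]
    refine pow_le_pow_of_le_one ht0.le ht1.le ?_
    have := ztwo m
    unfold zE
    rcases m with _ | m
    · omega
    · nlinarith [Nat.zero_le (x * (m+1)), Nat.zero_le (x.choose 2)]
  rw [zQ, abs_mul, abs_mul, abs_mul, abs_pow, abs_neg, abs_one, one_pow, one_mul,
    abs_of_pos (Real.exp_pos _), abs_of_pos (by positivity : 0 < t ^ zE x m)]
  calc _ ≤ Real.exp (-τ) * (t ^ m / t * ((x + 1 : ℕ) * (1 / p * (1 / (p * p)) * (2 / (p * p) * Real.exp τ)))) := by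
        gcongr
    _ = _ := by
        rw [Real.exp_neg]
        have := (Real.exp_pos τ).ne'
        field_simp

open Filter Topology in
lemma zc_tendsto {t : ℝ} (ht0 : 0 < t) (ht1 : t < 1) (hp : 0 < tPochInf t) (k : ℕ) :
    Tendsto (fun j => zc t j k) atTop (𝓝 (if k ≤ 1 then (tPochInf t)⁻¹ else 0)) := by
  have hP := (zP_tendsto ht0 ht1).inv₀ hp.ne'
  have hz : Tendsto (fun j : ℕ => t ^ j) atTop (𝓝 0) :=
    tendsto_pow_atTop_nhds_zero_of_lt_one ht0.le ht1
  rcases k with _ | _ | k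
  · have : (fun j => zc t j 0) = fun j => (tPochN t j)⁻¹ := by
      funext j; simp [zc, zP_zero]
    rw [this]; simpa using hP
  · have : (fun j => zc t j (0+1)) = fun j => ((t ^ j * t + (1 - t)) / (1 - t)) * (tPochN t j)⁻¹ := by
      funext j
      have h1 : 1 - t ≠ 0 := (sub_pos.2 ht1).ne'
      have h2 := (zP_pos ht0 ht1 j).ne'
      have := ht0.ne'
      simp [zc, zP_zero, zP_succ]
      field_simp
    rw [this]
    have h1 : 1 - t ≠ 0 := (sub_pos.2 ht1).ne'
    have := (((hz.mul_const t).add_const (1 - t)).div_const (1 - t)).mul hP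
    simpa [h1] using this
  · have : (fun j => zc t j (k+1+1)) = fun j => (t ^ j * ((t ^ j) ^ k *
        (t ^ (k+1+1).choose 2 * (t ^ j * t ^ (k+1+1) + (1 - t ^ (k+1+1))) / tPochN t (k+1+1)))) * (tPochN t j)⁻¹ := by
      funext j
      have h1 := (zP_pos ht0 ht1 (k+1+1)).ne'
      have h2 := (zP_pos ht0 ht1 j).ne'
      have := ht0.ne'
      simp only [zc]
      generalize (k+1+1).choose 2 = Y
      field_simp
      ring
    rw [this]
    have := (hz.mul ((hz.pow k).mul ((((hz.mul_const (t ^ (k+1+1))).add_const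
      (1 - t ^ (k+1+1))).const_mul (t ^ (k+1+1).choose 2)).div_const (tPochN t (k+1+1))))).mul hP
    simpa using this

lemma zqinf (p τ : ℝ) (k : ℕ) : ∑ l ∈ Finset.range (k + 1), (if l ≤ 1 then p else 0) *
    (τ ^ (k - l) / ((k - l).factorial : ℝ)) = p * (τ ^ k / (k.factorial : ℝ) +
      if 1 ≤ k then τ ^ (k - 1) / ((k - 1).factorial : ℝ) else 0) := by
  rcases k with _ | k
  · simp
  · rw [Finset.sum_range_succ', Finset.sum_range_succ', Finset.sum_eq_zero]
    · simp; ring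
    · intro l _; simp

lemma zFterm {t : ℝ} (χ : ℝ) (L : ℤ) (x m : ℕ) :
    (tPochInf t)⁻¹ * Fterm t χ L x m = Real.exp (-(χ * t ^ (L - (m:ℤ)))) * ((-1) ^ m * t ^ zE x m *
      ∑ i ∈ Finset.range (x + 1), zw t (x - i) * zA t m i *
        ∑ l ∈ Finset.range (i + m + 1), (if l ≤ 1 then (tPochInf t)⁻¹ else 0) *
          ((χ * t ^ (L - (m:ℤ))) ^ (i + m - l) / ((i + m - l).factorial : ℝ))) := by
  have hx : (x:ℤ) * ((x:ℤ) - 1) / 2 = (x.choose 2 : ℕ) := by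
    have : ((2 * x.choose 2 + x : ℕ) : ℤ) = ((x * x : ℕ) : ℤ) := by rw [ztwo]
    push_cast at this
    rw [show (x:ℤ) * ((x:ℤ) - 1) = 2 * (x.choose 2 : ℕ) by linarith]
    simp
  have he : (m : ℤ) ^ 2 + ((x : ℤ) - 1) * (m : ℤ) + (x : ℤ) * ((x : ℤ) - 1) / 2 = (zE x m : ℕ) := by
    rw [hx, zE]
    have : ((2 * m.choose 2 + m : ℕ) : ℤ) = ((m * m : ℕ) : ℤ) := by rw [ztwo]
    push_cast at this ⊢
    linarith
  unfold Fterm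
  rw [he, zpow_natCast]
  simp only [zqinf]
  have hA : ∀ i, tBinomN t (m + i) i = zA t m i := by
    intro i
    simp [tBinomN, zA, mul_comm]
  simp only [hA, zw, neg_mul, mul_comm (t ^ (L - (m:ℤ))) χ, Finset.mul_sum]
  refine Finset.sum_congr rfl fun i _ => ?_
  ring

open Filter Topology

theorem stmt17 (t χ : ℝ) (ht0 : 0 < t) (ht1 : t < 1) (hχ : 0 < χ) (L : ℤ) (x : ℕ) :
    0 ≤ Fweight t χ L x := by
  have hp0 : 0 ≤ tPochInf t :=
    ge_of_tendsto' (zP_tendsto ht0 ht1) fun n => (zP_pos ht0 ht1 n).le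
  rcases hp0.eq_or_lt with hp | hp
  · simp [Fweight, ← hp]
  rw [Fweight, ← tsum_mul_left]
  have hlim := tendsto_tsum_of_dominated_convergence (𝓕 := atTop)
    (f := fun r m : ℕ => if m ≤ r then Real.exp (-(χ * t ^ (L - (m:ℤ)))) *
      zQ t x m (r - m) (χ * t ^ (L - (m:ℤ))) else 0)
    (g := fun m => (tPochInf t)⁻¹ * Fterm t χ L x m)
    (bound := fun m => ((x + 1 : ℕ) * (1 / tPochInf t * (1 / (tPochInf t * tPochInf t)) *
        (2 / (tPochInf t * tPochInf t))) / t) * t ^ m)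
    ((summable_geometric_of_lt_one ht0.le ht1).mul_left _) ?_ ?_
  · refine ge_of_tendsto' hlim fun r => ?_
    have hz := zp_nonneg ht0 ht1 r x (χ * t ^ (L - (r:ℤ))) (by positivity)
    refine hz.trans (le_of_eq ?_)
    rw [tsum_eq_sum (s := Finset.range (r+1))]
    · refine Finset.sum_congr rfl fun m hm => ?_
      have hm' := Nat.lt_succ_iff.1 (Finset.mem_range.1 hm)
      have e : χ * t ^ (L - (r:ℤ)) * t ^ (r - m) = χ * t ^ (L - (m:ℤ)) := by
        rw [mul_assoc, ← zpow_natCast, ← zpow_add₀ ht0.ne', Nat.cast_sub hm']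
        congr 2; ring
      rw [e, if_pos hm']
    · intro m hm
      have : ¬ m ≤ r := fun h => hm (Finset.mem_range.2 (Nat.lt_succ_iff.2 h))
      simp [this]
  · intro m
    simp only [zFterm]
    have hq : Tendsto (fun r : ℕ => Real.exp (-(χ * t ^ (L - (m:ℤ)))) *
        zQ t x m (r - m) (χ * t ^ (L - (m:ℤ)))) atTop (𝓝 (Real.exp (-(χ * t ^ (L - (m:ℤ)))) * ((-1) ^ m * t ^ zE x m *
      ∑ i ∈ Finset.range (x + 1), zw t (x - i) * zA t m i *
        ∑ l ∈ Finset.range (i + m + 1), (if l ≤ 1 then (tPochInf t)⁻¹ else 0) *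
          ((χ * t ^ (L - (m:ℤ))) ^ (i + m - l) / ((i + m - l).factorial : ℝ))))) := by
      unfold zQ zq
      refine Tendsto.const_mul _ (Tendsto.const_mul _ (tendsto_finsetSum _ fun i _ =>
        Tendsto.const_mul _ (tendsto_finsetSum _ fun l _ => Tendsto.mul_const _ ?_)))
      exact (zc_tendsto ht0 ht1 hp l).comp (tendsto_sub_atTop_nat m)
    refine hq.congr' ?_
    filter_upwards [eventually_ge_atTop m] with r hr
    rw [if_pos hr]
  · refine Eventually.of_forall fun r m => ?_
    have hb := zQ_bound ht0 ht1 hp x m (r - m) (τ := χ * t ^ (L - (m:ℤ))) (by positivity)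
    by_cases h : m ≤ r
    · simpa only [if_pos h, Real.norm_eq_abs] using hb
    · rw [if_neg h, norm_zero]
      exact (abs_nonneg _).trans hb
end

section
/- Let t be real with 0 < t < 1, let m ≥ 0 be an integer, and let z be a nonzero complex number with z ∉ {−t^n : n ∈ ℤ}. Then the bilateral series Σ_{L∈ℤ} t^{−(m+1)L} / (−t^{−L} z;t)_∞ converges absolutely and Σ_{L∈ℤ} t^{−(m+1)L} / (−t^{−L} z;t)_∞ = (t;t)_m · z^{−m−1} · t^{−m(m+1)/2}. -/
open scoped BigOperators

open Filter Topology in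
theorem aux_P (t : ℝ) (ht0 : 0 < t) (ht1 : t < 1) (z : ℂ) :
    Multipliable (fun i : ℕ => 1 + z * (t : ℂ) ^ i) ∧
    Summable (fun i : ℕ => ‖z * (t : ℂ) ^ i‖) := by
  have hs : Summable (fun i : ℕ => ‖z * (t : ℂ) ^ i‖) := by
    have : Summable (fun i : ℕ => ‖z‖ * t ^ i) :=
      (summable_geometric_of_lt_one ht0.le ht1).mul_left _
    refine this.congr fun i => ?_
    rw [norm_mul, norm_pow, Complex.norm_real, Real.norm_of_nonneg ht0.le]
  exact ⟨multipliable_one_add_of_summable hs, hs⟩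

open Filter Topology in
theorem aux_main (t : ℝ) (ht0 : 0 < t) (ht1 : t < 1) (z : ℂ) (hz0 : z ≠ 0)
    (g : ℤ → ℂ) (hg0 : ∀ L, g L ≠ 0)
    (hg : ∀ L : ℤ, g (L - 1) = (1 + (t : ℂ) ^ (-L) * z) * g L)
    (hlim : Tendsto (fun n : ℕ => g (-(n : ℤ))) atTop (𝓝 1)) (m : ℕ) :
    Summable (fun L : ℤ => (t : ℂ) ^ (-((m : ℤ) + 1) * L) * g L) ∧
    ∑' L : ℤ, (t : ℂ) ^ (-((m : ℤ) + 1) * L) * g L =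
      ((tPochN t m : ℝ) : ℂ) * z ^ (-((m : ℤ) + 1)) *
        (t : ℂ) ^ (-((m : ℤ) * ((m : ℤ) + 1) / 2)) := by
  have htc : (t : ℂ) ≠ 0 := by exact_mod_cast ht0.ne'
  have hnt : ‖(t : ℂ)‖ = t := by rw [Complex.norm_real, Real.norm_of_nonneg ht0.le]
  have htp : Tendsto (fun n : ℕ => (t : ℂ) ^ n) atTop (𝓝 0) :=
    tendsto_pow_atTop_nhds_zero_of_norm_lt_one (by rw [hnt]; exact ht1)
  have hne : ∀ k L : ℤ, (t : ℂ) ^ k * g L ≠ 0 := fun k L => mul_ne_zero (zpow_ne_zero _ htc) (hg0 L)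
  have hfac : ∀ L : ℤ, 1 + (t : ℂ) ^ (-L) * z ≠ 0 := by
    intro L h
    have := hg L
    rw [h, zero_mul] at this
    exact hg0 _ this
  have hsum : ∀ m : ℕ, Summable (fun L : ℤ => (t : ℂ) ^ (-((m : ℤ) + 1) * L) * g L) := by
    intro m
    refine Summable.of_nat_of_neg ?_ ?_
    · refine summable_of_ratio_test_tendsto_lt_one zero_lt_one
        (Eventually.of_forall fun n => hne _ _) ?_
      have key : Tendsto (fun n : ℕ => ‖(t : ℂ) ^ (-((m : ℤ) + 1)) * (t : ℂ) ^ (n + 1) /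
          ((t : ℂ) ^ (n + 1) + z)‖) atTop (𝓝 0) := by
        have h1 := (tendsto_add_atTop_iff_nat 1).2 htp
        have h2 := ((h1.const_mul ((t : ℂ) ^ (-((m : ℤ) + 1)))).div (h1.add_const z)
          (by simpa using hz0)).norm
        simpa using h2
      refine key.congr fun n => ?_
      rw [← norm_div]
      congr 1
      have h3 := hg ((n : ℤ) + 1)
      have h4 := hfac ((n : ℤ) + 1)
      rw [add_sub_cancel_right] at h3
      have h5 : (t : ℂ) ^ (-((n : ℤ) + 1)) = ((t : ℂ) ^ (n + 1))⁻¹ := by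
        rw [zpow_neg]; norm_cast
      rw [h5] at h3 h4
      have h6 : (t : ℂ) ^ (n + 1) ≠ 0 := pow_ne_zero _ htc
      have h7 : (t : ℂ) ^ (n + 1) + z ≠ 0 := by
        intro h; apply h4; field_simp; rw [h, mul_zero]
      have h8 : (t : ℂ) ^ (-((m : ℤ) + 1) * ((n : ℤ) + 1)) =
          (t : ℂ) ^ (-((m : ℤ) + 1) * (n : ℤ)) * (t : ℂ) ^ (-((m : ℤ) + 1)) := by
        rw [← zpow_add₀ htc]; congr 1; ring
      push_cast
      rw [h8, h3]
      have h9 : (t : ℂ) ^ (-((m : ℤ) + 1) * (n : ℤ)) ≠ 0 := zpow_ne_zero _ htc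
      have h10 := hg0 ((n : ℤ) + 1)
      generalize (t : ℂ) ^ (-((m : ℤ) + 1) * (n : ℤ)) = A at *
      generalize (t : ℂ) ^ (-((m : ℤ) + 1)) = B at *
      generalize (t : ℂ) ^ (n + 1) = C at *
      generalize g ((n : ℤ) + 1) = D at *
      have h11 : 1 + C⁻¹ * z = (C + z) / C := by field_simp
      rw [h11]
      field_simp
    · refine summable_of_ratio_test_tendsto_lt_one (l := t ^ (m + 1))
        (pow_lt_one₀ ht0.le ht1 (by omega))
        (Eventually.of_forall fun n => hne _ _) ?_
      have key : Tendsto (fun n : ℕ => ‖(t : ℂ) ^ (m + 1) * (1 + (t : ℂ) ^ n * z)‖)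
          atTop (𝓝 (t ^ (m + 1))) := by
        have h2 := (((htp.mul_const z).const_add 1).const_mul ((t : ℂ) ^ (m + 1))).norm
        simpa [abs_of_pos ht0] using h2
      refine key.congr fun n => ?_
      rw [← norm_div]
      congr 1
      have h3 := hg (-(n : ℤ))
      have h5 : (t : ℂ) ^ (- -(n : ℤ)) = (t : ℂ) ^ n := by
        rw [neg_neg]; norm_cast
      rw [h5] at h3
      have h8 : (t : ℂ) ^ (-((m : ℤ) + 1) * (-((n : ℤ) + 1))) =
          (t : ℂ) ^ (-((m : ℤ) + 1) * (-(n : ℤ))) * (t : ℂ) ^ (m + 1) := by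
        rw [← zpow_natCast, ← zpow_add₀ htc]; congr 1; push_cast; ring
      push_cast
      rw [h8, show -((n : ℤ) + 1) = -(n : ℤ) - 1 by ring, h3]
      have h9 : (t : ℂ) ^ (-((m : ℤ) + 1) * (-(n : ℤ))) ≠ 0 := zpow_ne_zero _ htc
      have h10 := hg0 (-(n : ℤ))
      field_simp
  refine ⟨hsum m, ?_⟩
  induction m with
  | zero =>
    have hs := hsum 0
    have hg' : ∀ L : ℤ, (t : ℂ) ^ (-(((0 : ℕ) : ℤ) + 1) * L) * g L = z⁻¹ * (g (L - 1) - g L) := by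
      intro L
      rw [hg L]
      have : -(((0 : ℕ) : ℤ) + 1) * L = -L := by push_cast; ring
      rw [this]; field_simp; ring
    have hpos : Tendsto (fun n : ℕ => g (n : ℤ)) atTop (𝓝 0) := by
      have h1 : Summable (fun n : ℕ => (t : ℂ) ^ (-(((0 : ℕ) : ℤ) + 1) * (n : ℤ)) * g n) :=
        hs.comp_injective (i := fun n : ℕ => (n : ℤ)) Nat.cast_injective
      have h2 := htp.mul h1.tendsto_atTop_zero
      rw [zero_mul] at h2
      refine h2.congr fun n => ?_
      rw [← mul_assoc, ← zpow_natCast, ← zpow_add₀ htc]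
      simp
    have hs' : Summable (fun L : ℤ => g (L - 1) - g L) := by
      have := hs.mul_left z
      refine this.congr fun L => ?_
      rw [hg' L]; field_simp
    have hA : HasSum (fun n : ℕ => g ((n : ℤ) - 1) - g n) (g (-1)) := by
      have h1 : Summable (fun n : ℕ => g ((n : ℤ) - 1) - g n) :=
        hs'.comp_injective (i := fun n : ℕ => (n : ℤ)) Nat.cast_injective
      refine (h1.hasSum_iff_tendsto_nat).2 ?_
      rw [← tendsto_add_atTop_iff_nat 1]
      have h2 : Tendsto (fun n : ℕ => g (-1) - g n) atTop (𝓝 (g (-1))) := by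
        simpa using hpos.const_sub (g (-1))
      refine h2.congr fun n => ?_
      induction n with
      | zero => simp
      | succ n ih =>
        rw [Finset.sum_range_succ, ← ih]; push_cast; rw [add_sub_cancel_right]; ring
    have hB : HasSum (fun n : ℕ => g (-((n : ℤ) + 1) - 1) - g (-((n : ℤ) + 1))) (1 - g (-1)) := by
      have h1 : Summable (fun n : ℕ => g (-((n : ℤ) + 1) - 1) - g (-((n : ℤ) + 1))) :=
        hs'.comp_injective (i := fun n : ℕ => -((n : ℤ) + 1)) (fun a b h => by simpa using h)
      refine (h1.hasSum_iff_tendsto_nat).2 ?_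
      have h2 : Tendsto (fun n : ℕ => g (-((n + 1 : ℕ) : ℤ)) - g (-1)) atTop (𝓝 (1 - g (-1))) :=
        ((tendsto_add_atTop_iff_nat (f := fun n : ℕ => g (-(n : ℤ))) 1).2 hlim).sub_const _
      refine h2.congr fun n => ?_
      induction n with
      | zero => simp
      | succ n ih =>
        rw [Finset.sum_range_succ, ← ih]; push_cast
        rw [show -((n : ℤ) + 1 + 1) = -((n : ℤ) + 1) - 1 by ring]; ring
    have hT := (HasSum.of_nat_of_neg_add_one (f := fun L : ℤ => g (L - 1) - g L) hA hB).tsum_eq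
    simp_rw [hg']
    rw [tsum_mul_left, hT]
    simp [tPochN]
  | succ m ih =>
    have e : ∀ L : ℤ, (t : ℂ) ^ (-(((m + 1 : ℕ) : ℤ) + 1) * L) * g L =
        z⁻¹ * ((t : ℂ) ^ (-((m : ℤ) + 1)) * ((t : ℂ) ^ (-((m : ℤ) + 1) * (L - 1)) * g (L - 1)) -
          (t : ℂ) ^ (-((m : ℤ) + 1) * L) * g L) := by
      intro L
      rw [hg L, ← mul_assoc ((t : ℂ) ^ _), ← zpow_add₀ htc,
        show -((m : ℤ) + 1) + -((m : ℤ) + 1) * (L - 1) = -((m : ℤ) + 1) * L by ring,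
        show -(((m + 1 : ℕ) : ℤ) + 1) * L = -((m : ℤ) + 1) * L + -L by push_cast; ring,
        zpow_add₀ htc]
      field_simp; ring
    simp_rw [e]
    have hs1 : Summable (fun L : ℤ => (t : ℂ) ^ (-((m : ℤ) + 1) * (L - 1)) * g (L - 1)) :=
      (Equiv.subRight (1 : ℤ)).summable_iff.2 (hsum m)
    have ht1' : ∑' L : ℤ, (t : ℂ) ^ (-((m : ℤ) + 1) * (L - 1)) * g (L - 1) =
        ∑' L : ℤ, (t : ℂ) ^ (-((m : ℤ) + 1) * L) * g L :=
      (Equiv.subRight (1 : ℤ)).tsum_eq (fun L : ℤ => (t : ℂ) ^ (-((m : ℤ) + 1) * L) * g L)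
    rw [tsum_mul_left, (hs1.mul_left _).tsum_sub (hsum m), tsum_mul_left, ht1', ih]
    have hP : ((tPochN t (m + 1) : ℝ) : ℂ) = (tPochN t m : ℝ) * (1 - (t : ℂ) ^ (m + 1)) := by
      unfold tPochN; rw [Finset.prod_range_succ]; push_cast; rfl
    have hE : -(((m + 1 : ℕ) : ℤ) * (((m + 1 : ℕ) : ℤ) + 1) / 2) =
        -((m : ℤ) * ((m : ℤ) + 1) / 2) + -((m : ℤ) + 1) := by
      push_cast
      rw [show ((m : ℤ) + 1) * ((m : ℤ) + 1 + 1) = (m : ℤ) * ((m : ℤ) + 1) + ((m : ℤ) + 1) * 2 by ring,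
        Int.add_mul_ediv_right _ _ two_ne_zero]
      ring
    have hZ : z ^ (-(((m + 1 : ℕ) : ℤ) + 1)) = z ^ (-((m : ℤ) + 1)) * z⁻¹ := by
      rw [← zpow_sub_one₀ hz0]; congr 1
    have hQ : (t : ℂ) ^ (-((m : ℤ) + 1)) * (t : ℂ) ^ (m + 1) = 1 := by
      rw [← zpow_natCast, ← zpow_add₀ htc]; simp
    rw [hP, hE, hZ, zpow_add₀ htc]
    linear_combination ((tPochN t m : ℝ) : ℂ) * z ^ (-((m : ℤ) + 1)) * z⁻¹ * (t : ℂ) ^ (-((m : ℤ) * ((m : ℤ) + 1) / 2)) * hQ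

open Filter Topology in
theorem stmt19 (t : ℝ) (ht0 : 0 < t) (ht1 : t < 1) (m : ℕ) (z : ℂ) (hz0 : z ≠ 0)
    (hz : ∀ n : ℤ, z ≠ -((t ^ n : ℝ) : ℂ)) :
    (Summable fun L : ℤ =>
      ‖((t ^ (-((m : ℤ) + 1) * L) : ℝ) : ℂ) /
        ∏' i : ℕ, (1 + ((t ^ (-L) : ℝ) : ℂ) * z * (t : ℂ) ^ i)‖) ∧
    ∑' L : ℤ,
        ((t ^ (-((m : ℤ) + 1) * L) : ℝ) : ℂ) /
          ∏' i : ℕ, (1 + ((t ^ (-L) : ℝ) : ℂ) * z * (t : ℂ) ^ i) =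
      ((tPochN t m : ℝ) : ℂ) * z ^ (-((m : ℤ) + 1)) *
        ((t ^ (-((m : ℤ) * ((m : ℤ) + 1) / 2)) : ℝ) : ℂ) := by
  have htc : (t : ℂ) ≠ 0 := by exact_mod_cast ht0.ne'
  simp only [Complex.ofReal_zpow, div_eq_mul_inv]
  set P : ℤ → ℂ := fun L => ∏' i : ℕ, (1 + (t : ℂ) ^ (-L) * z * (t : ℂ) ^ i) with hPdef
  have hP0 : ∀ L, P L ≠ 0 := by
    intro L
    refine tprod_one_add_ne_zero_of_summable (fun i h => ?_) (aux_P t ht0 ht1 _).2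
    apply hz (L - i)
    push_cast
    have h1 : (t : ℂ) ^ (-L) * (t : ℂ) ^ i * (t : ℂ) ^ (L - (i : ℤ)) = 1 := by
      rw [← zpow_natCast, ← zpow_add₀ htc, ← zpow_add₀ htc]
      simp
    linear_combination (t : ℂ) ^ (L - (i : ℤ)) * h - z * h1
  have hrec : ∀ L, P L = (1 + (t : ℂ) ^ (-L) * z) * P (L - 1) := by
    intro L
    have h := (aux_P t ht0 ht1 ((t : ℂ) ^ (-(L - 1)) * z)).1
    have h2 : ∀ i : ℕ, 1 + (t : ℂ) ^ (-L) * z * (t : ℂ) ^ (i + 1) =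
        1 + (t : ℂ) ^ (-(L - 1)) * z * (t : ℂ) ^ i := by
      intro i
      rw [show -(L - 1) = -L + 1 by ring, zpow_add_one₀ htc]; ring
    have h3 := tprod_eq_zero_mul' (f := fun i : ℕ => 1 + (t : ℂ) ^ (-L) * z * (t : ℂ) ^ i)
      (by simp only [h2]; exact h)
    simp only [h2, pow_zero, mul_one] at h3
    exact h3
  have hlim : Tendsto (fun n : ℕ => (P (-(n : ℤ)))⁻¹) atTop (𝓝 1) := by
    have h1 := (aux_P t ht0 ht1 z).1.hasProd.tendsto_prod_nat
    have h0 : P 0 = ∏' i : ℕ, (1 + z * (t : ℂ) ^ i) := by simp [hPdef]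
    rw [← h0] at h1
    have h2 := h1.mul_const (P 0)⁻¹
    rw [mul_inv_cancel₀ (hP0 0)] at h2
    refine h2.congr fun n => ?_
    have h3 : P 0 = (∏ i ∈ Finset.range n, (1 + z * (t : ℂ) ^ i)) * P (-(n : ℤ)) := by
      induction n with
      | zero => simp
      | succ n ih =>
        rw [Finset.prod_range_succ, ih, hrec (-(n : ℤ))]
        push_cast
        rw [show -((n : ℤ) + 1) = -(n : ℤ) - 1 by ring, neg_neg, zpow_natCast]; ring
    have h4 := hP0 0
    have h5 := hP0 (-(n : ℤ))
    refine eq_inv_of_mul_eq_one_left ?_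
    rw [mul_right_comm, ← h3, mul_inv_cancel₀ h4]
  have := aux_main t ht0 ht1 z hz0 (fun L => (P L)⁻¹) (fun L => inv_ne_zero (hP0 L)) (fun L => by
    have h1 := hrec L
    have h2 := hP0 L
    have h3 := hP0 (L - 1)
    rw [inv_eq_iff_eq_inv, mul_inv, inv_inv, h1]
    have h4 : 1 + (t : ℂ) ^ (-L) * z ≠ 0 := by
      intro h; rw [h, zero_mul] at h1; exact h2 h1
    rw [inv_mul_cancel_left₀ h4]) hlim m
  exact ⟨this.1.norm, this.2⟩
end
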